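/- arXiv:1103.5852 — 7 statements merged into one kernel-verified Lean document; each statement's English description precedes it below -/
import Mathlib

section
/- Let k be a field of characteristic 0, A an associative commutative unital k-algebra, E₁ and E₂ A-modules, and D : E₁ → E₂ a k-linear map. For f ∈ A define δ(f)(D) = D∘(f·) − (f·)∘D, where (f·) denotes multiplication by f on E₁ resp. E₂. Then for every natural number n the following are equivalent: (i) δ(f₁)δ(f₂)⋯δ(f_{n+1})(D) = 0 for all f₁,…,f_{n+1} ∈ A; (ii) δ(f)^{n+1}(D) = 0 for all f ∈ A. -/
/-- `deltaOp f D = D ∘ (f • ·) − (f • ·) ∘ D`. -/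
def deltaOp {A : Type*} [CommRing A] {E₁ E₂ : Type*}
    [AddCommGroup E₁] [AddCommGroup E₂] [Module A E₁] [Module A E₂]
    (f : A) (D : E₁ → E₂) : E₁ → E₂ :=
  fun x => D (f • x) - f • D x

open Polynomial in
theorem eq_zero_of_forall_sum_pow_smul_eq_zero {k V : Type*} [Field k] [CharZero k]
    [AddCommGroup V] [Module k V] {N : ℕ} {c : ℕ → V}
    (h : ∀ t : k, ∑ i ∈ Finset.range N, t ^ i • c i = 0) {i : ℕ} (hi : i < N) : c i = 0 := by
  rw [← Module.forall_dual_apply_eq_zero_iff k]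
  intro φ
  have hp : (∑ j ∈ Finset.range N, C (φ (c j)) * X ^ j : k[X]) = 0 := by
    refine Polynomial.funext fun t => ?_
    have ht := congrArg φ (h t)
    simp only [map_sum, map_smul, smul_eq_mul, map_zero] at ht
    simp only [eval_finsetSum, eval_mul, eval_C, eval_pow, eval_X, eval_zero, mul_comm (φ _), ht]
  simpa [finsetSum_coeff, coeff_C_mul, coeff_X_pow, hi] using congrArg (fun p => p.coeff i) hp

section Polarization

variable {k A V : Type*} [Field k] [CharZero k] [AddCommGroup A] [Module k A]
  [AddCommGroup V] [Module k V] {L : A →ₗ[k] Module.End k V}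

theorem pow_apply_apply_eq_zero_of_forall_pow_succ_apply_eq_zero
    (hL : ∀ f g, Commute (L f) (L g)) {r : ℕ} {v : V}
    (h : ∀ f, (L f ^ (r + 1)) v = 0) (f g : A) : (L f ^ r) (L g v) = 0 := by
  have hc := eq_zero_of_forall_sum_pow_smul_eq_zero (k := k) (N := r + 2) (i := 1)
    (c := fun i => (L g ^ i * L f ^ (r + 1 - i) * ((r + 1).choose i : Module.End k V)) v)
    (fun t => by
      have ht := h (t • g + f)
      rw [map_add, map_smul, ((hL g f).smul_left t).add_pow, LinearMap.sum_apply] at ht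
      rw [← ht]
      refine Finset.sum_congr rfl fun i _ => ?_
      rw [smul_pow, smul_mul_assoc, smul_mul_assoc, LinearMap.smul_apply])
    (by omega)
  simp only [pow_one, Nat.add_sub_cancel, Nat.choose_one_right] at hc
  rw [← (Nat.cast_commute (r + 1) _).eq, ← nsmul_eq_mul, LinearMap.smul_apply,
    ← Nat.cast_smul_eq_nsmul k] at hc
  have hz := (smul_eq_zero.mp hc).resolve_left (Nat.cast_ne_zero.mpr r.succ_ne_zero)
  rwa [((hL g f).pow_right r).eq] at hz

theorem list_map_prod_apply_eq_zero_of_forall_pow_apply_eq_zero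
    (hL : ∀ f g, Commute (L f) (L g)) (l : List A) {v : V}
    (h : ∀ f, (L f ^ l.length) v = 0) : (l.map L).prod v = 0 := by
  induction l generalizing v with
  | nil => simpa using h 0
  | cons g l ih =>
    have hg : Commute (L g) (l.map L).prod :=
      Commute.list_prod_right _ _ fun x hx => by
        obtain ⟨f, -, rfl⟩ := List.mem_map.mp hx
        exact hL g f
    rw [List.map_cons, List.prod_cons, hg.eq]
    exact ih fun f => pow_apply_apply_eq_zero_of_forall_pow_succ_apply_eq_zero hL h f g

end Polarization

section DeltaOp

variable (k : Type*) [Field k] {A : Type*} [CommRing A] [Algebra k A]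
  (E₁ E₂ : Type*) [AddCommGroup E₁] [AddCommGroup E₂] [Module A E₁] [Module A E₂]
  [Module k E₁] [Module k E₂] [IsScalarTower k A E₁] [IsScalarTower k A E₂]

/-- `deltaOp` as a linear map into the endomorphisms of `E₁ →ₗ[k] E₂`. -/
def deltaLinear : A →ₗ[k] Module.End k (E₁ →ₗ[k] E₂) :=
  LinearMap.mk₂ k
    (fun f D => D ∘ₗ Algebra.lsmul k k E₁ f - Algebra.lsmul k k E₂ f ∘ₗ D)
    (fun f g D => by ext x; simp; abel)
    (fun c f D => by ext x; simp [smul_sub])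
    (fun f D D' => by ext x; simp; abel)
    (fun c f D => by ext x; simp [smul_sub, smul_comm f c])

variable {k E₁ E₂}

theorem coe_deltaLinear (f : A) (D : E₁ →ₗ[k] E₂) :
    ⇑(deltaLinear k E₁ E₂ f D) = deltaOp f ⇑D := rfl

theorem deltaLinear_commute (f g : A) :
    Commute (deltaLinear k E₁ E₂ f) (deltaLinear k E₁ E₂ g) := by
  ext D x
  simp only [Module.End.mul_apply, coe_deltaLinear, deltaOp, smul_sub, smul_comm f g]
  abel

theorem coe_list_map_deltaLinear_prod (l : List A) (D : E₁ →ₗ[k] E₂) :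
    ⇑((l.map (deltaLinear k E₁ E₂)).prod D) = l.foldr deltaOp ⇑D := by
  induction l with
  | nil => rfl
  | cons f l ih =>
    rw [List.map_cons, List.prod_cons, Module.End.mul_apply, coe_deltaLinear, ih,
      List.foldr_cons]

theorem coe_deltaLinear_pow (f : A) (m : ℕ) (D : E₁ →ₗ[k] E₂) :
    ⇑((deltaLinear k E₁ E₂ f ^ m) D) = (deltaOp f)^[m] ⇑D := by
  induction m with
  | zero => rfl
  | succ m ih =>
    rw [pow_succ', Module.End.mul_apply, coe_deltaLinear, ih, Function.iterate_succ_apply']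

end DeltaOp

/-- For a `k`-linear map `D : E₁ → E₂` between modules over a commutative unital
`k`-algebra `A` (`k` a field of characteristic 0) and every natural number `n`:
`δ(f₁)⋯δ(f_{n+1})(D) = 0` for all `f₁,…,f_{n+1} ∈ A` iff `δ(f)^{n+1}(D) = 0` for all `f ∈ A`. -/
theorem differential_operator_order_iff
    {k : Type*} [Field k] [CharZero k]
    {A : Type*} [CommRing A] [Algebra k A]
    {E₁ E₂ : Type*} [AddCommGroup E₁] [AddCommGroup E₂]
    [Module A E₁] [Module A E₂]
    [Module k E₁] [Module k E₂] [IsScalarTower k A E₁] [IsScalarTower k A E₂]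
    (D : E₁ →ₗ[k] E₂) (n : ℕ) :
    (∀ f : Fin (n + 1) → A, (List.ofFn f).foldr deltaOp ⇑D = 0)
      ↔ (∀ f : A, (deltaOp f)^[n + 1] ⇑D = 0) := by
  constructor
  · intro h f
    rw [← h fun _ => f, ← coe_deltaLinear_pow, ← coe_list_map_deltaLinear_prod,
      List.ofFn_const, List.map_replicate, List.prod_replicate]
  · intro h f
    rw [← coe_list_map_deltaLinear_prod, LinearMap.coe_zero_iff]
    refine list_map_prod_apply_eq_zero_of_forall_pow_apply_eq_zero deltaLinear_commute _ fun g => ?_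
    rw [← LinearMap.coe_zero_iff, coe_deltaLinear_pow, List.length_ofFn, h g]
end

section
/- Let k be a field of characteristic 0, A an associative commutative unital k-algebra, and E a faithful A-module. Let [·,·] : E × E → E be a k-bilinear bracket and ρ : E → Der(A) a map such that [X, fY] = f[X,Y] + ρ(X)(f)·Y for all X,Y ∈ E, f ∈ A, and such that (δ₁(f)δ₂(g)B)(X,Y) = 0 for all f,g ∈ A and X,Y ∈ E, where B denotes the bracket. Then the anchor ρ is A-linear: ρ(fX)(g) = f·ρ(X)(g) for all X ∈ E, f,g ∈ A. -/
/-- For a `k`-bilinear bracket `b` on a faithful `A`-module `E` with left anchor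
`ρ : E → Der(A)` (`[X,fY] = f[X,Y] + ρ(X)(f)Y`) which satisfies
`δ₁(f)δ₂(g)B = 0` for all `f, g ∈ A`, the anchor is `A`-linear:
`ρ(fX)(g) = f·ρ(X)(g)`. -/
theorem pseudoalgebra_anchor_A_linear
    {k : Type*} [Field k] [CharZero k]
    {A : Type*} [CommRing A] [Algebra k A]
    {E : Type*} [AddCommGroup E] [Module A E]
    [Module k E] [IsScalarTower k A E] [FaithfulSMul A E]
    (b : E →ₗ[k] E →ₗ[k] E) (ρ : E → Derivation k A A)
    (hanchor : ∀ (X Y : E) (f : A), b X (f • Y) = f • b X Y + ρ X f • Y)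
    (horder : ∀ (f g : A) (X Y : E),
      b (f • X) (g • Y) - g • b (f • X) Y - f • b X (g • Y) + f • g • b X Y = 0) :
    ∀ (X : E) (f g : A), ρ (f • X) g = f * ρ X g := by
  intro X f g
  refine FaithfulSMul.eq_of_smul_eq_smul (α := E) fun Y => ?_
  have h := horder f g X Y
  rw [hanchor, hanchor, smul_add, add_sub_cancel_left] at h
  rw [mul_smul, ← sub_eq_zero, ← h]
  abel
end

section
/- Let k be a field of characteristic 0, A an associative commutative unital k-algebra, and E a faithful A-module. Let [·,·] : E × E → E be a k-bilinear bracket with left anchor ρ : E → Der(A), i.e. [X, fY] = f[X,Y] + ρ(X)(f)·Y, and satisfying the Jacobi identity [X,[Y,Z]] = [[X,Y],Z] + [Y,[X,Z]]. Define X⋄Y = [X,Y] + [Y,X] and α(X)(f,Y) = [fY,X] − f[Y,X] + ρ(X)(f)·Y. Then for all X,Y,Z ∈ E and f ∈ A: [α(X)(f,Y), Z] = ρ(Z)(f)·(X⋄Y) − α(Z)(f, X⋄Y); in particular [α(X)(f,Y), Z] = [α(Y)(f,X), Z]. -/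
/-- Symmetrized products act trivially from the left in a Leibniz algebra. -/
theorem leibniz_symm_apply_eq_zero {k E : Type*} [CommRing k] [AddCommGroup E] [Module k E]
    (b : E →ₗ[k] E →ₗ[k] E)
    (hjac : ∀ X Y Z : E, b X (b Y Z) = b (b X Y) Z + b Y (b X Z)) (X Y Z : E) :
    b (b X Y + b Y X) Z = 0 := by
  have h := hjac X Y Z
  rw [hjac Y X Z, ← add_assoc, right_eq_add] at h
  rw [map_add, LinearMap.add_apply, h]

/-- For a `k`-bilinear Loday bracket `b` on a faithful `A`-module `E` with left anchor
`ρ : E → Der(A)`, setting `X⋄Y = [X,Y] + [Y,X]` and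
`α(X)(f,Y) = [fY,X] − f[Y,X] + ρ(X)(f)Y`, one has
`[α(X)(f,Y), Z] = ρ(Z)(f)·(X⋄Y) − α(Z)(f, X⋄Y)`; in particular
`[α(X)(f,Y), Z] = [α(Y)(f,X), Z]`. -/
theorem alpha_bracket_identity
    {k : Type*} [Field k] [CharZero k]
    {A : Type*} [CommRing A] [Algebra k A]
    {E : Type*} [AddCommGroup E] [Module A E]
    [Module k E] [IsScalarTower k A E] [FaithfulSMul A E]
    (b : E →ₗ[k] E →ₗ[k] E) (ρ : E → Derivation k A A)
    (hanchor : ∀ (X Y : E) (f : A), b X (f • Y) = f • b X Y + ρ X f • Y)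
    (hjac : ∀ X Y Z : E, b X (b Y Z) = b (b X Y) Z + b Y (b X Z)) :
    (∀ (X Y Z : E) (f : A),
      b (b (f • Y) X - f • b Y X + ρ X f • Y) Z
        = ρ Z f • (b X Y + b Y X)
          - (b (f • (b X Y + b Y X)) Z - f • b (b X Y + b Y X) Z
              + ρ Z f • (b X Y + b Y X))) ∧
    (∀ (X Y Z : E) (f : A),
      b (b (f • Y) X - f • b Y X + ρ X f • Y) Z
        = b (b (f • X) Y - f • b X Y + ρ Y f • X) Z) := by
  have key (X Y Z : E) (f : A) :
      b (b (f • Y) X - f • b Y X + ρ X f • Y) Z = -b (f • (b X Y + b Y X)) Z := by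
    have h : b (f • Y) X - f • b Y X + ρ X f • Y
        = (b X (f • Y) + b (f • Y) X) - f • (b X Y + b Y X) := by
      rw [hanchor, smul_add]
      abel
    rw [h, map_sub, LinearMap.sub_apply, leibniz_symm_apply_eq_zero b hjac, zero_sub]
  refine ⟨fun X Y Z f => ?_, fun X Y Z f => ?_⟩
  · rw [key, leibniz_symm_apply_eq_zero b hjac, smul_zero]
    abel
  · rw [key, key, add_comm (b X Y)]
end

section
/- Let k be a field of characteristic 0, A an associative commutative unital k-algebra, and E a faithful A-module. Let [·,·] : E × E → E be a Loday pseudoalgebra bracket: it satisfies the Jacobi identity [X,[Y,Z]] = [[X,Y],Z] + [Y,[X,Z]], it has a left anchor ρ : E → Der(A) with [X, fY] = f[X,Y] + ρ(X)(f)·Y, and it is a bidifferential operator of total order ≤ 1, i.e. (δ_i(f)δ_j(g)B)(X,Y) = 0 for all i,j ∈ {1,2}, f,g ∈ A, X,Y ∈ E. Let Ē be the A-submodule of E generated by {[X,X] : X ∈ E}. Then Ē is a two-sided ideal for the bracket: [Z,W] ∈ Ē and [W,Z] ∈ Ē for all Z ∈ E and W ∈ Ē. -/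
/-- The polarization `[X,Y] + [Y,X]` lies in the submodule generated by the squares. -/
theorem bracket_add_swap_mem_span_squares
    {k : Type*} [CommRing k] {A : Type*} [CommRing A]
    {E : Type*} [AddCommGroup E] [Module A E] [Module k E]
    (b : E →ₗ[k] E →ₗ[k] E) (X Y : E) :
    b X Y + b Y X ∈ Submodule.span A {w : E | ∃ X : E, w = b X X} := by
  have hsq : ∀ U : E, b U U ∈ Submodule.span A {w : E | ∃ X : E, w = b X X} :=
    fun U => Submodule.subset_span ⟨U, rfl⟩
  have h : b X Y + b Y X = b (X + Y) (X + Y) - b X X - b Y Y := by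
    simp only [map_add, LinearMap.add_apply]
    abel
  rw [h]
  exact Submodule.sub_mem _ (Submodule.sub_mem _ (hsq _) (hsq _)) (hsq _)


/-- For a Loday pseudoalgebra bracket `b` on a faithful `A`-module `E` (Jacobi identity,
left anchor `ρ : E → Der(A)`, bidifferential of total order ≤ 1), the `A`-submodule `Ē`
generated by the squares `[X,X]` is a two-sided ideal: `[Z,W] ∈ Ē` and `[W,Z] ∈ Ē` for
all `Z ∈ E`, `W ∈ Ē`. -/
theorem loday_pseudoalgebra_submodule_ideal
    {k : Type*} [Field k] [CharZero k]
    {A : Type*} [CommRing A] [Algebra k A]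
    {E : Type*} [AddCommGroup E] [Module A E]
    [Module k E] [IsScalarTower k A E] [FaithfulSMul A E]
    (b : E →ₗ[k] E →ₗ[k] E) (ρ : E → Derivation k A A)
    (hanchor : ∀ (X Y : E) (f : A), b X (f • Y) = f • b X Y + ρ X f • Y)
    (hjac : ∀ X Y Z : E, b X (b Y Z) = b (b X Y) Z + b Y (b X Z))
    (h11 : ∀ (f g : A) (X Y : E),
      b (g • (f • X)) Y - g • b (f • X) Y - f • b (g • X) Y + f • g • b X Y = 0)
    (h12 : ∀ (f g : A) (X Y : E),
      b (f • X) (g • Y) - g • b (f • X) Y - f • b X (g • Y) + f • g • b X Y = 0)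
    (h22 : ∀ (f g : A) (X Y : E),
      b X (g • (f • Y)) - g • b X (f • Y) - f • b X (g • Y) + f • g • b X Y = 0) :
    ∀ (Z W : E), W ∈ Submodule.span A {w : E | ∃ X : E, w = b X X} →
      b Z W ∈ Submodule.span A {w : E | ∃ X : E, w = b X X} ∧
      b W Z ∈ Submodule.span A {w : E | ∃ X : E, w = b X X} := by
  intro Z W hW
  have hleft : b Z W ∈ Submodule.span A {w : E | ∃ X : E, w = b X X} := by
    induction hW using Submodule.span_induction with
    | mem w hw =>
      obtain ⟨X, rfl⟩ := hw
      rw [hjac]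
      exact bracket_add_swap_mem_span_squares b _ _
    | zero => simp
    | add x y _ _ hx hy => simpa using Submodule.add_mem _ hx hy
    | smul f x hx ih =>
      rw [hanchor]
      exact Submodule.add_mem _ (Submodule.smul_mem _ _ ih) (Submodule.smul_mem _ _ hx)
  exact ⟨hleft, (Submodule.add_mem_iff_right _ hleft).1
    (bracket_add_swap_mem_span_squares b Z W)⟩
end

section
/- Let k be a field of characteristic 0, A an associative commutative unital k-algebra, and E a faithful A-module. Let [·,·] : E × E → E be a Loday pseudoalgebra bracket: it satisfies the Jacobi identity [X,[Y,Z]] = [[X,Y],Z] + [Y,[X,Z]], it has a left anchor ρ : E → Der(A) with [X, fY] = f[X,Y] + ρ(X)(f)·Y, and (δ_i(f)δ_j(g)B)(X,Y) = 0 for all i,j ∈ {1,2}, f,g ∈ A, X,Y ∈ E. Let Ē be the A-submodule of E generated by {[X,X] : X ∈ E}. Then the bracket descends to the quotient A-module E/Ē (if X − X′ ∈ Ē and Y − Y′ ∈ Ē then [X,Y] − [X′,Y′] ∈ Ē), and the induced bracket on E/Ē is skew-symmetric ([X,Y] + [Y,X] ∈ Ē for all X,Y ∈ E) and satisfies the Jacobi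 identity; i.e. E/Ē is a Lie pseudoalgebra with anchor induced by ρ. -/
/-- For a Loday pseudoalgebra bracket `b` on a faithful `A`-module `E` (Jacobi identity,
left anchor `ρ : E → Der(A)`, bidifferential of total order ≤ 1), with `Ē` the
`A`-submodule generated by the squares `[X,X]`: the bracket descends to the quotient
`A`-module `E/Ē`, the induced bracket is skew-symmetric and satisfies the Jacobi
identity, and the anchor descends as well; i.e. `E/Ē` is a Lie pseudoalgebra with
anchor induced by `ρ`. -/
theorem loday_pseudoalgebra_quotient_lie_pseudoalgebra
    {k : Type*} [Field k] [CharZero k]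
    {A : Type*} [CommRing A] [Algebra k A]
    {E : Type*} [AddCommGroup E] [Module A E]
    [Module k E] [IsScalarTower k A E] [FaithfulSMul A E]
    (b : E →ₗ[k] E →ₗ[k] E) (ρ : E → Derivation k A A)
    (hanchor : ∀ (X Y : E) (f : A), b X (f • Y) = f • b X Y + ρ X f • Y)
    (hjac : ∀ X Y Z : E, b X (b Y Z) = b (b X Y) Z + b Y (b X Z))
    (h11 : ∀ (f g : A) (X Y : E),
      b (g • (f • X)) Y - g • b (f • X) Y - f • b (g • X) Y + f • g • b X Y = 0)
    (h12 : ∀ (f g : A) (X Y : E),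
      b (f • X) (g • Y) - g • b (f • X) Y - f • b X (g • Y) + f • g • b X Y = 0)
    (h22 : ∀ (f g : A) (X Y : E),
      b X (g • (f • Y)) - g • b X (f • Y) - f • b X (g • Y) + f • g • b X Y = 0) :
    (∀ X X' Y Y' : E,
      X - X' ∈ Submodule.span A {w : E | ∃ Z : E, w = b Z Z} →
      Y - Y' ∈ Submodule.span A {w : E | ∃ Z : E, w = b Z Z} →
      b X Y - b X' Y' ∈ Submodule.span A {w : E | ∃ Z : E, w = b Z Z}) ∧
    (∀ X Y : E, b X Y + b Y X ∈ Submodule.span A {w : E | ∃ Z : E, w = b Z Z}) ∧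
    (∀ X Y Z : E, b X (b Y Z) - b (b X Y) Z - b Y (b X Z)
      ∈ Submodule.span A {w : E | ∃ Z : E, w = b Z Z}) ∧
    (∀ X X' : E, X - X' ∈ Submodule.span A {w : E | ∃ Z : E, w = b Z Z} →
      ∀ f : A, ρ X f = ρ X' f) := by
  set S := Submodule.span A {w : E | ∃ Z : E, w = b Z Z}
  have ext_smul : ∀ a c : A, (∀ Z : E, a • Z = c • Z) → a = c :=
    fun a c h => eq_of_smul_eq_smul h
  have square_mem : ∀ Z, b Z Z ∈ S := fun Z => Submodule.subset_span ⟨Z, rfl⟩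
  have skew : ∀ X Y : E, b X Y + b Y X ∈ S := by
    intro X Y
    have h := S.sub_mem (S.sub_mem (square_mem (X + Y)) (square_mem X)) (square_mem Y)
    have e : b (X + Y) (X + Y) - b X X - b Y Y = b X Y + b Y X := by
      simp only [map_add, LinearMap.add_apply]
      abel
    rwa [e] at h
  have anchor_smul : ∀ (X Y : E) (f : A), ρ X f • Y = b X (f • Y) - f • b X Y :=
    fun X Y f => by rw [hanchor]; abel
  have anchor_add : ∀ (X X' : E) (f : A), ρ (X + X') f = ρ X f + ρ X' f := by
    intro X X' f
    refine ext_smul _ _ fun Z => ?_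
    rw [add_smul, anchor_smul, anchor_smul, anchor_smul]
    simp only [map_add, LinearMap.add_apply, smul_add]
    abel
  have anchor_smul_left : ∀ (f : A) (X : E) (g : A), ρ (f • X) g = f * ρ X g := by
    intro f X g
    refine ext_smul _ _ fun Z => ?_
    rw [mul_smul, anchor_smul, anchor_smul, smul_sub, ← sub_eq_zero, ← h12 f g X Z]
    abel
  have anchor_square : ∀ (Z : E) (f : A), ρ (b Z Z) f = 0 := by
    have h : ∀ Z W : E, b (b Z Z) W = 0 := fun Z W => by simpa using hjac Z Z W
    intro Z f
    refine ext_smul _ _ fun W => ?_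
    rw [anchor_smul, h, h, smul_zero, sub_zero, zero_smul]
  have anchor_zero : ∀ f : A, ρ 0 f = 0 := fun f => by
    simpa using anchor_smul_left 0 0 f
  have anchor_mem : ∀ X ∈ S, ∀ f : A, ρ X f = 0 := by
    intro X hX f
    induction hX using Submodule.span_induction with
    | mem x hx => obtain ⟨Z, rfl⟩ := hx; exact anchor_square Z f
    | zero => exact anchor_zero f
    | add x y _ _ hx hy => rw [anchor_add, hx, hy, add_zero]
    | smul a x _ hx => rw [anchor_smul_left, hx, mul_zero]
  have right_mem : ∀ X, ∀ Y ∈ S, b X Y ∈ S := by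
    intro X Y hY
    induction hY using Submodule.span_induction with
    | mem x hx =>
      obtain ⟨Z, rfl⟩ := hx
      rw [hjac]
      exact skew _ _
    | zero => simp
    | add x y _ _ hx hy => rw [map_add]; exact S.add_mem hx hy
    | smul a x hxS hx =>
      rw [hanchor]
      exact S.add_mem (S.smul_mem _ hx) (S.smul_mem _ hxS)
  have left_mem : ∀ X ∈ S, ∀ Y, b X Y ∈ S := fun X hX Y =>
    (S.add_mem_iff_left (right_mem Y X hX)).1 (skew X Y)
  refine ⟨fun X X' Y Y' hX hY => ?_, skew, fun X Y Z => ?_, fun X X' hX f => ?_⟩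
  · have e : b X Y - b X' Y' = b (X - X') Y + b X' (Y - Y') := by
      simp only [map_sub, LinearMap.sub_apply]
      abel
    rw [e]
    exact S.add_mem (left_mem _ hX _) (right_mem _ _ hY)
  · rw [hjac, add_sub_cancel_left, sub_self]
    exact S.zero_mem
  · have h := anchor_add (X - X') X' f
    rwa [sub_add_cancel, anchor_mem _ hX, zero_add] at h
end

section
/- Let k be a field, V a k-vector space, W a nonzero k-vector space, [·,·] : V × V → V a k-bilinear bracket, and ρ : V → End_k(W) a k-linear map. For each p ≥ 0 let Lin^p(V,W) be the space of p-multilinear maps from V^p to W (with Lin^0(V,W) = W), and define ∂_B : Lin^p(V,W) → Lin^{p+1}(V,W) by (∂_B c)(x₁,…,x_{p+1}) = Σ_{i=1}^{p+1} (−1)^{i+1} ρ(x_i)(c(x₁,…,x̂_i,…,x_{p+1})) + Σ_{1≤i<j≤p+1} (−1)^i c(x₁,…,x̂_i,…,[x_i,x_j],…,x_{p+1}), where in the second sum the bracket [x_i,x_j] occupies the j-th slot. Then ∂_B∘∂_B = 0 on all of Lin^•(V,W) if and only if the bracket satisfies the Jacobi identity [x,[y,z]] = [[x,y],z] + [y,[x,z]]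 and ρ is a representation, i.e. ρ([x,y]) = ρ(x)∘ρ(y) − ρ(y)∘ρ(x), for all x,y,z ∈ V. -/
/-- The Loday coboundary operator associated with a bracket `brk : V → V → V` and a
map `ρ : V → W → W`, sending a `p`-cochain `c : V^p → W` to the `(p+1)`-cochain
`(∂c)(x₁,…,x_{p+1}) = Σ_i (−1)^{i+1} ρ(x_i)(c(x₁,…,x̂_i,…,x_{p+1}))
  + Σ_{i<j} (−1)^i c(x₁,…,x̂_i,…,[x_i,x_j]^{(j)},…,x_{p+1})`
(indices `1`-based in the formula, `0`-based in the implementation). -/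
def lodayD {V W : Type*} [AddCommGroup W]
    (brk : V → V → V) (ρ : V → W → W) {p : ℕ}
    (c : (Fin p → V) → W) : (Fin (p + 1) → V) → W :=
  fun x =>
    (∑ i : Fin (p + 1), ((-1 : ℤ) ^ (i : ℕ)) • ρ (x i) (c (x ∘ i.succAbove)))
    + ∑ i : Fin (p + 1), ∑ j : Fin (p + 1),
        if i < j then
          ((-1 : ℤ) ^ ((i : ℕ) + 1)) •
            c (fun l => if i.succAbove l = j then brk (x i) (x j) else x (i.succAbove l))
        else 0

/-- Insertion of `x` into the first slot of a cochain. -/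
def cochainInsert {V W : Type*} {p : ℕ} (x : V) (c : (Fin (p + 1) → V) → W) :
    (Fin p → V) → W :=
  fun r => c (Fin.cons x r)

/-- The Lie derivative of a cochain along `x`, for a bracket `brk` and an action `ρ`. -/
def cochainLie {V W : Type*} [AddCommGroup W] (brk : V → V → V) (ρ : V → W → W) {p : ℕ}
    (x : V) (c : (Fin p → V) → W) : (Fin p → V) → W :=
  fun r => ρ x (c r) - ∑ j, c (Function.update r j (brk x (r j)))

section Cartan

theorem cochain_ext_insert {V W : Type*} {p : ℕ} {c d : (Fin (p + 1) → V) → W}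
    (h : ∀ x, cochainInsert x c = cochainInsert x d) : c = d := by
  funext r
  have := congrFun (h (r 0)) (Fin.tail r)
  simpa [cochainInsert] using this

variable {V W : Type*} [AddCommGroup W]

theorem cochainInsert_sub {p : ℕ} (x : V) (c d : (Fin (p + 1) → V) → W) :
    cochainInsert x (c - d) = cochainInsert x c - cochainInsert x d := rfl

theorem cochainInsert_lodayD_zero (brk : V → V → V) (ρ : V → W → W) (x : V)
    (c : (Fin 0 → V) → W) :
    cochainInsert x (lodayD brk ρ c) = cochainLie brk ρ x c := by
  funext r
  simp [cochainInsert, lodayD, cochainLie]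

/-- The Cartan formula for the Loday coboundary. -/
theorem cochainInsert_lodayD (brk : V → V → V) (ρ : V → W → W) {p : ℕ} (x : V)
    (c : (Fin (p + 1) → V) → W) :
    cochainInsert x (lodayD brk ρ c)
      = cochainLie brk ρ x c - lodayD brk ρ (cochainInsert x c) := by
  funext r
  have h₀ : (Fin.cons x r : Fin (p + 2) → V) ∘ Fin.succAbove 0 = r := by
    funext l; simp
  have h₁ (i : Fin (p + 1)) : (Fin.cons x r : Fin (p + 2) → V) ∘ i.succ.succAbove
      = Fin.cons x (r ∘ i.succAbove) := by
    funext l; refine Fin.cases ?_ (fun l => ?_) l <;> simp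
  have h₂ (j : Fin (p + 1)) : (fun l => if Fin.succAbove 0 l = j.succ then brk x (r j)
      else (Fin.cons x r : Fin (p + 2) → V) (Fin.succAbove 0 l))
      = Function.update r j (brk x (r j)) := by
    funext l; by_cases h : l = j
    · subst h; simp
    · simp [h]
  have h₃ (i j : Fin (p + 1)) : (fun l => if i.succ.succAbove l = j.succ then brk (r i) (r j)
      else (Fin.cons x r : Fin (p + 2) → V) (i.succ.succAbove l))
      = Fin.cons x (fun l => if i.succAbove l = j then brk (r i) (r j)
          else r (i.succAbove l)) := by
    funext l; refine Fin.cases ?_ (fun l => ?_) l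
    · simp [(Fin.succ_ne_zero _).symm]
    · simp
  simp only [cochainInsert, lodayD, cochainLie, Pi.sub_apply]
  rw [Fin.sum_univ_succ, Fin.sum_univ_succ (n := p + 1)]
  simp only [Fin.sum_univ_succ (n := p + 1), Fin.cons_zero, Fin.cons_succ, h₀, h₁, h₂, h₃,
    Fin.succ_lt_succ_iff, Fin.succ_pos, if_true, Fin.not_lt_zero, if_false, lt_irrefl,
    Fin.val_zero, Fin.val_succ, pow_succ, pow_zero, one_smul, neg_smul, mul_neg,
    mul_one, neg_neg, zero_add, Finset.sum_neg_distrib]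
  have h₄ (i j : Fin (p + 1)) (a : W) :
      (if i < j then -a else 0) = -(if i < j then a else 0) := by
    split_ifs <;> simp
  simp only [h₄, Finset.sum_neg_distrib]
  abel

theorem cochainInsert_cochainLie (brk : V → V → V) (ρ : V → W → W) {p : ℕ} (x y : V)
    (c : (Fin (p + 1) → V) → W) :
    cochainInsert y (cochainLie brk ρ x c)
      = cochainLie brk ρ x (cochainInsert y c) - cochainInsert (brk x y) c := by
  funext r
  simp only [cochainInsert, cochainLie, Pi.sub_apply]
  rw [Fin.sum_univ_succ]
  simp only [Fin.cons_zero, Fin.cons_succ, Fin.update_cons_zero, ← Fin.cons_update]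
  abel

variable {k : Type*} [Field k] [AddCommGroup V] [Module k V] [Module k W]
  (b : V →ₗ[k] V →ₗ[k] V) (ρ : V →ₗ[k] W →ₗ[k] W)

theorem cochainLie_sub {p : ℕ} (x : V) (c d : (Fin p → V) → W) :
    cochainLie (fun u v => b u v) (fun u w => ρ u w) x (c - d)
      = cochainLie (fun u v => b u v) (fun u w => ρ u w) x c
        - cochainLie (fun u v => b u v) (fun u w => ρ u w) x d := by
  funext r
  simp only [cochainLie, Pi.sub_apply, map_sub, Finset.sum_sub_distrib]
  abel

theorem lodayD_sub {p : ℕ} (c d : (Fin p → V) → W) :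
    lodayD (fun u v => b u v) (fun u w => ρ u w) (c - d)
      = lodayD (fun u v => b u v) (fun u w => ρ u w) c
        - lodayD (fun u v => b u v) (fun u w => ρ u w) d := by
  funext r
  have h : ∀ (q : Prop) [Decidable q] (u v : W), (if q then u - v else 0)
      = (if q then u else 0) - (if q then v else 0) := by
    intro q _ u v; split_ifs <;> simp
  simp only [lodayD, Pi.sub_apply, map_sub, smul_sub, h, Finset.sum_sub_distrib]
  abel

theorem MultilinearMap.cochainInsert_eq {p : ℕ} (x : V)
    (c : MultilinearMap k (fun _ : Fin (p + 1) => V) W) :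
    cochainInsert x c = c.curryLeft x := rfl

theorem MultilinearMap.cochainInsert_add {p : ℕ} (x y : V)
    (c : MultilinearMap k (fun _ : Fin (p + 1) => V) W) :
    cochainInsert (x + y) c = cochainInsert x c + cochainInsert y c := by
  funext r
  exact c.cons_add r x y

variable {b ρ}

theorem cochainLie_bracket (hb : ∀ x y z : V, b x (b y z) = b (b x y) z + b y (b x z))
    (hρ : ∀ (x y : V) (w : W), ρ (b x y) w = ρ x (ρ y w) - ρ y (ρ x w)) {p : ℕ} (x y : V)
    (c : MultilinearMap k (fun _ : Fin p => V) W) :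
    cochainLie (fun u v => b u v) (fun u w => ρ u w) (b x y) c
      = cochainLie (fun u v => b u v) (fun u w => ρ u w) x
          (cochainLie (fun u v => b u v) (fun u w => ρ u w) y c)
        - cochainLie (fun u v => b u v) (fun u w => ρ u w) y
          (cochainLie (fun u v => b u v) (fun u w => ρ u w) x c) := by
  induction p with
  | zero =>
    funext r
    simp [cochainLie, hρ]
  | succ p ih =>
    refine cochain_ext_insert fun z => ?_
    simp only [cochainInsert_sub, cochainInsert_cochainLie, cochainLie_sub, hb x y z,
      MultilinearMap.cochainInsert_add]
    simp only [MultilinearMap.cochainInsert_eq, ih]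
    abel

theorem cochainLie_lodayD (hb : ∀ x y z : V, b x (b y z) = b (b x y) z + b y (b x z))
    (hρ : ∀ (x y : V) (w : W), ρ (b x y) w = ρ x (ρ y w) - ρ y (ρ x w)) {p : ℕ} (x : V)
    (c : MultilinearMap k (fun _ : Fin p => V) W) :
    cochainLie (fun u v => b u v) (fun u w => ρ u w) x
        (lodayD (fun u v => b u v) (fun u w => ρ u w) c)
      = lodayD (fun u v => b u v) (fun u w => ρ u w)
        (cochainLie (fun u v => b u v) (fun u w => ρ u w) x c) := by
  induction p with
  | zero =>
    refine cochain_ext_insert fun y => ?_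
    simp only [cochainInsert_cochainLie, cochainInsert_lodayD_zero, cochainLie_bracket hb hρ]
    abel
  | succ p ih =>
    refine cochain_ext_insert fun y => ?_
    simp only [cochainInsert_cochainLie, cochainInsert_lodayD, cochainLie_bracket hb hρ,
      cochainLie_sub, lodayD_sub, MultilinearMap.cochainInsert_eq, ih]
    abel

theorem lodayD_lodayD (hb : ∀ x y z : V, b x (b y z) = b (b x y) z + b y (b x z))
    (hρ : ∀ (x y : V) (w : W), ρ (b x y) w = ρ x (ρ y w) - ρ y (ρ x w)) {p : ℕ}
    (c : MultilinearMap k (fun _ : Fin p => V) W) :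
    lodayD (fun u v => b u v) (fun u w => ρ u w)
      (lodayD (fun u v => b u v) (fun u w => ρ u w) c) = 0 := by
  induction p with
  | zero =>
    refine cochain_ext_insert fun x => ?_
    rw [cochainInsert_lodayD, cochainInsert_lodayD_zero, cochainLie_lodayD hb hρ, sub_self]
    rfl
  | succ p ih =>
    refine cochain_ext_insert fun x => ?_
    rw [cochainInsert_lodayD, cochainInsert_lodayD, cochainLie_lodayD hb hρ, lodayD_sub,
      MultilinearMap.cochainInsert_eq, ih, sub_zero, sub_self]
    rfl

theorem map_bracket_of_lodayD_lodayD
    (h : ∀ (c : MultilinearMap k (fun _ : Fin 0 => V) W) (x : Fin 2 → V),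
      lodayD (fun u v => b u v) (fun u w => ρ u w)
        (lodayD (fun u v => b u v) (fun u w => ρ u w) c) x = 0)
    (x y : V) (w : W) : ρ (b x y) w = ρ x (ρ y w) - ρ y (ρ x w) := by
  have := congrArg (cochainInsert y) (congrArg (cochainInsert x)
    (funext (h (MultilinearMap.constOfIsEmpty k _ w))))
  simp only [cochainInsert_lodayD, cochainInsert_lodayD_zero, cochainInsert_cochainLie,
    cochainInsert_sub] at this
  have := congrFun this Fin.elim0
  simp [cochainLie, cochainInsert] at this
  rw [← sub_eq_zero, ← neg_eq_zero, ← this]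
  abel

theorem jacobi_of_lodayD_lodayD [Nontrivial W]
    (hρ : ∀ (x y : V) (w : W), ρ (b x y) w = ρ x (ρ y w) - ρ y (ρ x w))
    (h : ∀ (c : MultilinearMap k (fun _ : Fin 1 => V) W) (x : Fin 3 → V),
      lodayD (fun u v => b u v) (fun u w => ρ u w)
        (lodayD (fun u v => b u v) (fun u w => ρ u w) c) x = 0)
    (x y z : V) : b x (b y z) = b (b x y) z + b y (b x z) := by
  obtain ⟨w, hw⟩ := exists_ne (0 : W)
  rw [← sub_eq_zero]
  refine (Module.forall_dual_apply_eq_zero_iff k _).1 fun f => ?_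
  let c : MultilinearMap k (fun _ : Fin 1 => V) W :=
    MultilinearMap.ofSubsingleton k V W (0 : Fin 1) (f.smulRight w)
  have hc (v : V) (r : Fin 0 → V) : c (Fin.cons v r) = f v • w := by simp [c]
  have := congrArg (cochainInsert z) (congrArg (cochainInsert y) (congrArg (cochainInsert x)
    (funext (h c))))
  simp only [cochainInsert_lodayD, cochainInsert_lodayD_zero, cochainInsert_cochainLie,
    cochainInsert_sub, cochainLie_sub, lodayD_sub] at this
  have := congrFun this Fin.elim0
  simp [cochainLie, cochainInsert, hc, hρ] at this
  have hfw : f (b x (b y z) - (b (b x y) z + b y (b x z))) • w = 0 := by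
    simp only [map_sub, map_add, sub_smul, add_smul]
    rw [← neg_eq_zero, ← this]
    abel
  exact (smul_eq_zero.1 hfw).resolve_right hw

end Cartan

/-- Let `V` be a vector space over a field `k`, `W ≠ 0` a `k`-vector space,
`b : V × V → V` a `k`-bilinear bracket and `ρ : V → End_k(W)` a `k`-linear map. The
Loday coboundary operator `∂_B` squares to zero on all multilinear cochains
`Lin^•(V,W)` if and only if `b` satisfies the Loday–Jacobi identity and `ρ` is a
representation, `ρ([x,y]) = ρ(x)∘ρ(y) − ρ(y)∘ρ(x)`. -/
theorem loday_coboundary_squares_to_zero_iff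
    {k V W : Type*} [Field k]
    [AddCommGroup V] [Module k V] [AddCommGroup W] [Module k W] [Nontrivial W]
    (b : V →ₗ[k] V →ₗ[k] V) (ρ : V →ₗ[k] W →ₗ[k] W) :
    (∀ (p : ℕ) (c : MultilinearMap k (fun _ : Fin p => V) W) (x : Fin (p + 2) → V),
        lodayD (fun u v => b u v) (fun u w => ρ u w)
          (lodayD (fun u v => b u v) (fun u w => ρ u w) ⇑c) x = 0)
      ↔ ((∀ x y z : V, b x (b y z) = b (b x y) z + b y (b x z)) ∧
         (∀ (x y : V) (w : W), ρ (b x y) w = ρ x (ρ y w) - ρ y (ρ x w))) := by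
  refine ⟨fun h => ?_, fun ⟨hb, hρ⟩ p c x => congrFun (lodayD_lodayD hb hρ c) x⟩
  have hρ := map_bracket_of_lodayD_lodayD (h 0)
  exact ⟨jacobi_of_lodayD_lodayD hρ (h 1), hρ⟩
end

section
/- Let k be a field of characteristic 0, A an associative commutative unital k-algebra, E an A-module, [·,·] : E × E → E a k-bilinear bracket, and ρ : E → Der(A) a map (in the geometric case, E is the C^∞(M)-module of sections of a vector bundle over a manifold M and A = C^∞(M)). Let ∂_B denote the Loday operator: for a p-multilinear map c : E^p → A, (∂_B c)(X₁,…,X_{p+1}) = Σ_{i=1}^{p+1} (−1)^{i+1} ρ(X_i)(c(X₁,…,X̂_i,…,X_{p+1})) + Σ_{1≤i<j≤p+1} (−1)^i c(X₁,…,X̂_i,…,[X_i,X_j],…,X_{p+1}), the bracket inserted in the j-th slot; for f ∈ A, (∂_B f)(X) = ρ(X)(f). Then ∂_B is a degree 1 graded derivation of the shuffle product: for every p-multilinear ℓ′ : E^p → A and q-multilinear ℓ″ : E^q → A, ∂_B(ℓ′⋔ℓ″) = (∂_B ℓ′)⋔ℓ″ + (−1)^p ℓ′⋔(∂_B ℓ″).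 -/
/-- The shuffle product of a `p`-cochain and a `q`-cochain with values in a
commutative ring `A`:
`(ℓ₁⋔ℓ₂)(X₁,…,X_{p+q}) = Σ_{σ∈sh(p,q)} sign(σ)·ℓ₁(X_{σ(1)},…,X_{σ(p)})·ℓ₂(X_{σ(p+1)},…,X_{σ(p+q)})`. -/
def shuffleMul {A E : Type*} [CommRing A] {p q : ℕ}
    (ℓ₁ : (Fin p → E) → A) (ℓ₂ : (Fin q → E) → A) :
    (Fin (p + q) → E) → A :=
  fun x =>
    ∑ σ ∈ Finset.univ.filter (fun σ : Equiv.Perm (Fin (p + q)) =>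
        (∀ i j : Fin (p + q), i < j → (j : ℕ) < p → σ i < σ j) ∧
        (∀ i j : Fin (p + q), i < j → p ≤ (i : ℕ) → σ i < σ j)),
      ((Equiv.Perm.sign σ : ℤˣ) : ℤ) •
        (ℓ₁ (fun i => x (σ (Fin.castAdd q i))) * ℓ₂ (fun i => x (σ (Fin.natAdd p i))))

/-- A permutation that is increasing on each colour class of `c`. For `c l = decide (l < p)` these
are the shuffles of `{l < p}` and `{l ≥ p}`. -/
def IsColourShuffle {n : ℕ} (c : Fin n → Bool) (σ : Equiv.Perm (Fin n)) : Prop :=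
  ∀ i j : Fin n, i < j → c i = c j → σ i < σ j

/-- The permutation of `Fin (n + 1)` sending `a` to `i` and acting as `σ` on the complements. -/
def insertPerm {n : ℕ} (a i : Fin (n + 1)) (σ : Equiv.Perm (Fin n)) : Equiv.Perm (Fin (n + 1)) :=
  i.cycleRange.symm * Equiv.Perm.decomposeFin.symm (0, σ) * a.cycleRange

section insertPerm

variable {n : ℕ} (a i : Fin (n + 1)) (σ : Equiv.Perm (Fin n))

@[simp]
lemma insertPerm_self : insertPerm a i σ a = i := by
  simp [insertPerm]

@[simp]
lemma insertPerm_succAbove (l : Fin n) :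
    insertPerm a i σ (a.succAbove l) = i.succAbove (σ l) := by
  simp [insertPerm]

lemma sign_insertPerm :
    ((Equiv.Perm.sign (insertPerm a i σ) : ℤˣ) : ℤ) =
      (-1) ^ (i : ℕ) * (Equiv.Perm.sign σ : ℤˣ) * (-1) ^ (a : ℕ) := by
  simp [insertPerm, Fin.sign_cycleRange]

lemma insertPerm_bijective :
    Function.Bijective fun y : Fin (n + 1) × Equiv.Perm (Fin n) => insertPerm a y.1 y.2 := by
  rw [Fintype.bijective_iff_injective_and_card]
  refine ⟨?_, by simp [Fintype.card_perm, Nat.factorial_succ]⟩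
  rintro ⟨i, σ⟩ ⟨j, τ⟩ h
  have hij : i = j := by simpa using congrArg (fun π => π a) h
  subst hij
  refine Prod.ext rfl (Equiv.ext fun l => ?_)
  simpa using congrArg (fun π => π (a.succAbove l)) h

variable {a i σ} {c : Fin n → Bool} {c' : Fin (n + 1) → Bool} {v : Bool}

lemma IsColourShuffle.of_insertPerm (hc : ∀ l, c' (a.succAbove l) = c l)
    (h : IsColourShuffle c' (insertPerm a i σ)) : IsColourShuffle c σ := by
  intro l m hlm hcol
  have := h (a.succAbove l) (a.succAbove m) (by simpa using hlm) (by rw [hc, hc, hcol])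
  simpa using this

lemma IsColourShuffle.lt_iff (hc : ∀ l, c' (a.succAbove l) = c l)
    (h : IsColourShuffle c' (insertPerm a i σ)) {l : Fin n} (hl : c l = c' a) :
    i < i.succAbove (σ l) ↔ a < a.succAbove l := by
  have hl' : c' (a.succAbove l) = c' a := by rw [hc, hl]
  constructor
  · intro hi
    by_contra hlt
    have h1 := h (a.succAbove l) a (lt_of_le_of_ne (not_lt.1 hlt) (Fin.succAbove_ne a l)) hl'
    simp only [insertPerm_self, insertPerm_succAbove] at h1
    exact absurd hi h1.asymm
  · intro ha
    simpa using h a (a.succAbove l) ha hl'.symm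

lemma IsColourShuffle.insertPerm_iff (hc : ∀ l, c' (a.succAbove l) = c l)
    (hσ : IsColourShuffle c σ) :
    IsColourShuffle c' (insertPerm a i σ) ↔
      ∀ l, c l = c' a → (a ≤ l.castSucc ↔ i ≤ (σ l).castSucc) := by
  constructor
  · intro h l hl
    rw [← Fin.lt_succAbove_iff_le_castSucc, ← Fin.lt_succAbove_iff_le_castSucc, h.lt_iff hc hl]
  · intro h j j' hj hcol
    rcases Fin.eq_self_or_eq_succAbove a j with rfl | ⟨l, rfl⟩
    · rcases Fin.eq_self_or_eq_succAbove j j' with rfl | ⟨m, rfl⟩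
      · exact absurd hj (lt_irrefl _)
      · rw [insertPerm_self, insertPerm_succAbove, Fin.lt_succAbove_iff_le_castSucc,
          ← h m (by rw [← hc, hcol])]
        rwa [Fin.lt_succAbove_iff_le_castSucc] at hj
    · rcases Fin.eq_self_or_eq_succAbove a j' with rfl | ⟨m, rfl⟩
      · rw [insertPerm_self, insertPerm_succAbove, Fin.succAbove_lt_iff_castSucc_lt, ← not_le,
          ← h l (by rw [← hc, hcol]), not_le]
        rwa [Fin.succAbove_lt_iff_castSucc_lt] at hj
      · simp only [insertPerm_succAbove, Fin.succAbove_lt_succAbove_iff] at hj ⊢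
        exact hσ l m hj (by rw [← hc, ← hc, hcol])

/-- There is exactly one position of colour `v` at which the value `i` can be inserted in a
shuffle. -/
lemma IsColourShuffle.existsUnique_insertPerm
    (hc : ∀ a, c' a = v → ∀ l, c' (a.succAbove l) = c l) (hv : ∃ a, c' a = v)
    (hσ : IsColourShuffle c σ) (i : Fin (n + 1)) :
    ∃! a, c' a = v ∧ IsColourShuffle c' (insertPerm a i σ) := by
  classical
  let S : Finset (Fin (n + 1)) := Finset.univ.filter fun a =>
    c' a = v ∧ ∀ l, c l = v → a ≤ l.castSucc → i ≤ (σ l).castSucc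
  have hS : S.Nonempty := by
    let V := Finset.univ.filter fun a => c' a = v
    have hV : V.Nonempty := hv.imp fun a ha => by simpa [V] using ha
    have hm : c' (V.max' hV) = v := by simpa [V] using V.max'_mem hV
    refine ⟨V.max' hV, ?_⟩
    simp only [S, Finset.mem_filter, Finset.mem_univ, true_and]
    refine ⟨hm, fun l hl hle => ?_⟩
    have h1 : (V.max' hV).succAbove l ∈ V := by simpa [V, hc _ hm l] using hl
    exact absurd (V.le_max' _ h1) (not_le.2 ((Fin.lt_succAbove_iff_le_castSucc _ _).2 hle))
  obtain ⟨a, hmem, hmin⟩ := S.exists_min_image id hS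
  simp only [S, Finset.mem_filter, Finset.mem_univ, true_and, id] at hmem hmin
  obtain ⟨ha, hle⟩ := hmem
  have s : IsColourShuffle c' (insertPerm a i σ) := by
    refine (hσ.insertPerm_iff (hc a ha)).2 fun l hl => ⟨hle l (hl.trans ha), fun hi => ?_⟩
    by_contra hla
    rw [not_le] at hla
    rw [ha] at hl
    refine absurd (hmin l.castSucc ⟨?_, fun m hm hlm => ?_⟩) (not_le.2 hla)
    · rw [← Fin.succAbove_of_castSucc_lt a l hla, hc a ha, hl]
    · rcases (Fin.castSucc_le_castSucc_iff.1 hlm).eq_or_lt with rfl | hlt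
      · exact hi
      · exact hi.trans (Fin.castSucc_le_castSucc_iff.2 (hσ l m hlt (hl.trans hm.symm)).le)
  have key : ∀ a₁ a₂, c' a₁ = v → IsColourShuffle c' (insertPerm a₁ i σ) →
      c' a₂ = v → IsColourShuffle c' (insertPerm a₂ i σ) → ¬ a₁ < a₂ := by
    intro a₁ a₂ h₁ s₁ h₂ s₂ hlt
    obtain ⟨l, rfl⟩ := Fin.exists_castSucc_eq.2 (hlt.trans_le (Fin.le_last _)).ne
    have hl : c l = v := by
      rw [← hc a₂ h₂, Fin.succAbove_of_castSucc_lt a₂ l hlt, h₁]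
    have e₁ := (hσ.insertPerm_iff (hc _ h₁)).1 s₁ l (hl.trans h₁.symm)
    have e₂ := (hσ.insertPerm_iff (hc _ h₂)).1 s₂ l (hl.trans h₂.symm)
    exact absurd (e₂.2 (e₁.1 le_rfl)) (not_le.2 hlt)
  exact ⟨a, ⟨ha, s⟩, fun a' ⟨ha', s'⟩ =>
    le_antisymm (not_lt.1 (key a a' ha s ha' s')) (not_lt.1 (key a' a ha' s' ha s))⟩

open Classical in
/-- Summing over shuffles `τ` of `Fin (n + 1)` with a marked position `e b` of colour `v` amounts to
summing over the marked value `i` and the shuffle `σ` of `Fin n` obtained by deleting it. -/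
lemma sum_isColourShuffle_insertPerm {ι M : Type*} [Fintype ι] [AddCommMonoid M]
    (hc : ∀ a, c' a = v → ∀ l, c' (a.succAbove l) = c l) (e : ι → Fin (n + 1))
    (he : Function.Injective e) (hev : ∀ a, c' a = v ↔ ∃ b, e b = a) [Nonempty ι]
    (G : Equiv.Perm (Fin (n + 1)) → ι → M) (F : Fin (n + 1) → Equiv.Perm (Fin n) → M)
    (hGF : ∀ b i σ, IsColourShuffle c' (insertPerm (e b) i σ) →
      G (insertPerm (e b) i σ) b = F i σ) :
    ∑ τ with IsColourShuffle c' τ, ∑ b, G τ b = ∑ i, ∑ σ with IsColourShuffle c σ, F i σ := by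
  have hve : ∀ b, c' (e b) = v := fun b => (hev _).2 ⟨b, rfl⟩
  rw [Finset.sum_comm]
  have step : ∀ b, ∑ τ with IsColourShuffle c' τ, G τ b =
      ∑ y : Fin (n + 1) × Equiv.Perm (Fin n),
        if IsColourShuffle c' (insertPerm (e b) y.1 y.2) then F y.1 y.2 else 0 := by
    intro b
    rw [Finset.sum_filter, ← (insertPerm_bijective (e b)).sum_comp]
    exact Finset.sum_congr rfl fun y _ => by
      split_ifs with h
      · exact hGF b y.1 y.2 h
      · rfl
  rw [Finset.sum_congr rfl fun b _ => step b, Finset.sum_comm, Fintype.sum_prod_type]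
  refine Finset.sum_congr rfl fun i _ => ?_
  rw [Finset.sum_filter]
  refine Finset.sum_congr rfl fun σ _ => ?_
  dsimp only
  split_ifs with hσ
  · obtain ⟨a, ⟨ha, hs⟩, huniq⟩ :=
      hσ.existsUnique_insertPerm hc ⟨_, hve (Classical.arbitrary ι)⟩ i
    obtain ⟨b, rfl⟩ := (hev a).1 ha
    rw [Finset.sum_eq_single b, if_pos hs]
    · intro b' _ hb'
      exact if_neg fun h => hb' (he (huniq _ ⟨hve b', h⟩))
    · simp
  · exact Finset.sum_eq_zero fun b _ => if_neg fun h => hσ (h.of_insertPerm (hc _ (hve b)))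

end insertPerm

section lodayD

variable {k A E : Type*} [Field k] [CommRing A] [Algebra k A]

/-- The Lie-derivative-like operator `c ↦ ρ(u)(c(z)) − Σ_m c(z₁,…,[u,z_m],…)`, where `m` runs over
the indices with `P m`. -/
def partialLie (brk : E → E → E) (ρ : E → Derivation k A A) {n : ℕ} (u : E) (P : Fin n → Prop)
    [DecidablePred P] (c : (Fin n → E) → A) (z : Fin n → E) : A :=
  ρ u (c z) - ∑ m, if P m then c (Function.update z m (brk u (z m))) else 0

variable (brk : E → E → E) (ρ : E → Derivation k A A)

lemma lodayD_eq_sum_partialLie {n : ℕ} (c : (Fin n → E) → A) (x : Fin (n + 1) → E) :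
    lodayD brk (fun u f => ρ u f) c x = ∑ i : Fin (n + 1), ((-1 : ℤ) ^ (i : ℕ)) •
      partialLie brk ρ (x i) (fun m => i < i.succAbove m) c (x ∘ i.succAbove) := by
  rw [lodayD, ← Finset.sum_add_distrib]
  refine Finset.sum_congr rfl fun i _ => ?_
  rw [partialLie, smul_sub, sub_eq_add_neg, Fin.sum_univ_succAbove _ i, if_neg (lt_irrefl i),
    zero_add, Finset.smul_sum, ← Finset.sum_neg_distrib]
  congr 1
  refine Finset.sum_congr rfl fun m _ => ?_
  have h : (fun l => if i.succAbove l = i.succAbove m then brk (x i) (x (i.succAbove m))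
      else x (i.succAbove l)) =
      Function.update (x ∘ i.succAbove) m (brk (x i) ((x ∘ i.succAbove) m)) := by
    ext l
    simp [Function.update_apply]
  rw [h]
  split_ifs <;> simp [pow_succ]

lemma partialLie_perm {n : ℕ} (u : E) (P : Fin n → Prop) [DecidablePred P]
    (c : (Fin n → E) → A) (z : Fin n → E) (σ : Equiv.Perm (Fin n)) :
    partialLie brk ρ u P (fun y => c (y ∘ σ)) z =
      partialLie brk ρ u (fun m => P (σ m)) c (z ∘ σ) := by
  rw [partialLie, partialLie, ← Equiv.sum_comp σ]
  congr 1
  refine Finset.sum_congr rfl fun m _ => ?_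
  rw [Function.update_comp_eq_of_injective _ σ.injective]
  rfl

lemma partialLie_sum_smul {n : ℕ} {ι : Type*} (s : Finset ι) (r : ι → ℤ) (u : E)
    (P : Fin n → Prop) [DecidablePred P] (c : ι → (Fin n → E) → A) (z : Fin n → E) :
    partialLie brk ρ u P (fun y => ∑ t ∈ s, r t • c t y) z =
      ∑ t ∈ s, r t • partialLie brk ρ u P (c t) z := by
  simp only [partialLie, map_sum, map_zsmul, smul_sub, Finset.sum_sub_distrib, Finset.smul_sum]
  congr 1
  rw [Finset.sum_comm]
  refine Finset.sum_congr rfl fun m _ => ?_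
  split_ifs <;> simp

lemma partialLie_mul {p q : ℕ} (u : E) (P : Fin (p + q) → Prop) [DecidablePred P]
    (ℓ₁ : (Fin p → E) → A) (ℓ₂ : (Fin q → E) → A) (z : Fin (p + q) → E) :
    partialLie brk ρ u P (fun y => ℓ₁ (y ∘ Fin.castAdd q) * ℓ₂ (y ∘ Fin.natAdd p)) z =
      partialLie brk ρ u (fun m => P (Fin.castAdd q m)) ℓ₁ (z ∘ Fin.castAdd q) *
          ℓ₂ (z ∘ Fin.natAdd p) +
        ℓ₁ (z ∘ Fin.castAdd q) *
          partialLie brk ρ u (fun m => P (Fin.natAdd p m)) ℓ₂ (z ∘ Fin.natAdd p) := by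
  have h₁ : ∀ (m : Fin p) (w : E), Function.update z (Fin.castAdd q m) w ∘ Fin.castAdd q =
      Function.update (z ∘ Fin.castAdd q) m w := fun m w =>
    Function.update_comp_eq_of_injective _ (Fin.castAdd_injective p q) _ _
  have h₂ : ∀ (m : Fin q) (w : E), Function.update z (Fin.natAdd p m) w ∘ Fin.natAdd p =
      Function.update (z ∘ Fin.natAdd p) m w := fun m w =>
    Function.update_comp_eq_of_injective _ (Fin.natAdd_injective q p) _ _
  have h₃ : ∀ (m : Fin p) (w : E), Function.update z (Fin.castAdd q m) w ∘ Fin.natAdd p =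
      z ∘ Fin.natAdd p := fun m w =>
    Function.update_comp_eq_of_notMem_range _ _ (by
      rintro ⟨l, hl⟩
      have := congrArg Fin.val hl
      simp only [Fin.val_natAdd, Fin.val_castAdd] at this
      omega)
  have h₄ : ∀ (m : Fin q) (w : E), Function.update z (Fin.natAdd p m) w ∘ Fin.castAdd q =
      z ∘ Fin.castAdd q := fun m w =>
    Function.update_comp_eq_of_notMem_range _ _ (by
      rintro ⟨l, hl⟩
      have := congrArg Fin.val hl
      simp only [Fin.val_natAdd, Fin.val_castAdd] at this
      omega)
  simp only [partialLie, Derivation.leibniz, smul_eq_mul, Fin.sum_univ_add, h₁, h₂, h₃, h₄,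
    sub_mul, mul_sub, Finset.sum_mul, Finset.mul_sum, ite_mul, mul_ite, zero_mul, mul_zero,
    Function.comp_apply]
  ring

end lodayD

lemma isColourShuffle_lt_iff {n : ℕ} (p : ℕ) (σ : Equiv.Perm (Fin n)) :
    IsColourShuffle (fun l => decide ((l : ℕ) < p)) σ ↔
      (∀ i j : Fin n, i < j → (j : ℕ) < p → σ i < σ j) ∧
        (∀ i j : Fin n, i < j → p ≤ (i : ℕ) → σ i < σ j) := by
  simp only [IsColourShuffle, decide_eq_decide]
  constructor
  · exact fun h => ⟨fun i j hij hj => h i j hij (by omega), fun i j hij hi => h i j hij (by omega)⟩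
  · rintro ⟨h₁, h₂⟩ i j hij hcol
    by_cases hj : (j : ℕ) < p
    · exact h₁ i j hij hj
    · exact h₂ i j hij (by omega)

open Classical in
lemma shuffleMul_comp_cast {A E : Type*} [CommRing A] {p q n : ℕ} (h : p + q = n)
    (ℓ₁ : (Fin p → E) → A) (ℓ₂ : (Fin q → E) → A) (x : Fin n → E) :
    shuffleMul ℓ₁ ℓ₂ (x ∘ Fin.cast h) =
      ∑ σ : Equiv.Perm (Fin n) with IsColourShuffle (fun l => decide ((l : ℕ) < p)) σ,
        ((Equiv.Perm.sign σ : ℤˣ) : ℤ) •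
          (ℓ₁ (fun m => x (σ (Fin.cast h (Fin.castAdd q m)))) *
            ℓ₂ (fun m => x (σ (Fin.cast h (Fin.natAdd p m))))) := by
  subst h
  refine Finset.sum_congr ?_ fun σ _ => rfl
  ext σ
  simp only [Finset.mem_filter, Finset.mem_univ, true_and, isColourShuffle_lt_iff]

section derivation

variable {k A E : Type*} [Field k] [CommRing A] [Algebra k A]
  (brk : E → E → E) (ρ : E → Derivation k A A) {p q : ℕ}
  (ℓ₁ : (Fin p → E) → A) (ℓ₂ : (Fin q → E) → A) (x : Fin (p + q + 1) → E)

/-- The contribution to `∂(ℓ₁⋔ℓ₂)` of a shuffle `σ` and an index `i` acting on `ℓ₁`. -/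
def lodayLeftTerm (i : Fin (p + q + 1)) (σ : Equiv.Perm (Fin (p + q))) : A :=
  ((-1 : ℤ) ^ (i : ℕ) * (Equiv.Perm.sign σ : ℤˣ)) •
    (partialLie brk ρ (x i) (fun m => i < i.succAbove (σ (Fin.castAdd q m))) ℓ₁
        (fun m => x (i.succAbove (σ (Fin.castAdd q m)))) *
      ℓ₂ (fun m => x (i.succAbove (σ (Fin.natAdd p m)))))

/-- The contribution to `∂(ℓ₁⋔ℓ₂)` of a shuffle `σ` and an index `i` acting on `ℓ₂`. -/
def lodayRightTerm (i : Fin (p + q + 1)) (σ : Equiv.Perm (Fin (p + q))) : A :=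
  ((-1 : ℤ) ^ (i : ℕ) * (Equiv.Perm.sign σ : ℤˣ)) •
    (ℓ₁ (fun m => x (i.succAbove (σ (Fin.castAdd q m)))) *
      partialLie brk ρ (x i) (fun m => i < i.succAbove (σ (Fin.natAdd p m))) ℓ₂
        (fun m => x (i.succAbove (σ (Fin.natAdd p m)))))

open Classical in
lemma lodayD_shuffleMul : lodayD brk (fun u f => ρ u f) (shuffleMul ℓ₁ ℓ₂) x =
    ∑ i, ∑ σ with IsColourShuffle (fun l => decide ((l : ℕ) < p)) σ,
      (lodayLeftTerm brk ρ ℓ₁ ℓ₂ x i σ + lodayRightTerm brk ρ ℓ₁ ℓ₂ x i σ) := by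
  rw [lodayD_eq_sum_partialLie]
  refine Finset.sum_congr rfl fun i _ => ?_
  let c : (Fin (p + q) → E) → A := fun z => ℓ₁ (z ∘ Fin.castAdd q) * ℓ₂ (z ∘ Fin.natAdd p)
  have hs : shuffleMul ℓ₁ ℓ₂ = fun y => ∑ σ : Equiv.Perm (Fin (p + q)) with
      IsColourShuffle (fun l => decide ((l : ℕ) < p)) σ, ((Equiv.Perm.sign σ : ℤˣ) : ℤ) •
        c (y ∘ σ) :=
    funext fun y => shuffleMul_comp_cast rfl ℓ₁ ℓ₂ y
  rw [hs]
  refine (congrArg (((-1 : ℤ) ^ (i : ℕ)) • ·) (partialLie_sum_smul brk ρ _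
    (fun σ => ((Equiv.Perm.sign σ : ℤˣ) : ℤ)) (x i) (fun m => i < i.succAbove m)
    (fun σ y => c (y ∘ σ)) _)).trans ?_
  rw [Finset.smul_sum]
  refine Finset.sum_congr rfl fun σ _ => ?_
  rw [partialLie_perm, partialLie_mul, smul_smul, smul_add]
  rfl

open Classical in
lemma shuffleMul_lodayD_left (hN : p + 1 + q = p + q + 1) :
    shuffleMul (lodayD brk (fun u f => ρ u f) ℓ₁) ℓ₂ (x ∘ Fin.cast hN) =
      ∑ i, ∑ σ with IsColourShuffle (fun l => decide ((l : ℕ) < p)) σ,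
        lodayLeftTerm brk ρ ℓ₁ ℓ₂ x i σ := by
  let e : Fin (p + 1) → Fin (p + q + 1) := fun a => Fin.cast hN (Fin.castAdd q a)
  have hcol : ∀ a : Fin (p + q + 1), decide ((a : ℕ) < p + 1) = true →
      ∀ l, decide ((a.succAbove l : ℕ) < p + 1) = decide ((l : ℕ) < p) := by
    intro a ha l
    simp only [decide_eq_true_eq, decide_eq_decide, Fin.succAbove, Fin.lt_def] at ha ⊢
    split_ifs with h <;> simp at h ⊢
    omega
  have hA : ∀ a m, e (a.succAbove m) = (e a).succAbove (Fin.castAdd q m) := by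
    intro a m
    ext
    simp only [e, Fin.succAbove, Fin.lt_def, Fin.val_cast, Fin.val_castAdd, Fin.val_castSucc]
    split_ifs <;> simp
  have hB : ∀ a m, Fin.cast hN (Fin.natAdd (p + 1) m) = (e a).succAbove (Fin.natAdd p m) := by
    intro a m
    ext
    simp only [e, Fin.succAbove, Fin.lt_def, Fin.val_cast, Fin.val_castAdd, Fin.val_castSucc,
      Fin.val_natAdd]
    split_ifs <;> simp <;> omega
  rw [shuffleMul_comp_cast hN]
  simp only [lodayD_eq_sum_partialLie, Finset.sum_mul, Finset.smul_sum]
  refine sum_isColourShuffle_insertPerm hcol e ?_ ?_ _ _ ?_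
  · exact (Fin.cast_injective hN).comp (Fin.castAdd_injective _ _)
  · intro a
    rw [decide_eq_true_eq]
    exact ⟨fun h => ⟨⟨a, h⟩, rfl⟩, by rintro ⟨m, rfl⟩; exact m.2⟩
  · intro a i σ h
    have hlt : ∀ m, i < i.succAbove (σ (Fin.castAdd q m)) ↔ a < a.succAbove m := by
      intro m
      rw [h.lt_iff (hcol _ (decide_eq_true a.2))
        ((decide_eq_true m.2).trans (decide_eq_true a.2).symm), ← hA]
      rfl
    have hA' : ∀ m, insertPerm (e a) i σ (Fin.cast hN (Fin.castAdd q (a.succAbove m))) =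
        i.succAbove (σ (Fin.castAdd q m)) := fun m =>
      (congrArg _ (hA a m)).trans (insertPerm_succAbove _ _ _ _)
    have hB' : ∀ m, insertPerm (e a) i σ (Fin.cast hN (Fin.natAdd (p + 1) m)) =
        i.succAbove (σ (Fin.natAdd p m)) := fun m =>
      (congrArg _ (hB a m)).trans (insertPerm_succAbove _ _ _ _)
    have ha : insertPerm (e a) i σ (Fin.cast hN (Fin.castAdd q a)) = i := insertPerm_self _ _ _
    have hsign : ((Equiv.Perm.sign (insertPerm (e a) i σ) : ℤˣ) : ℤ) * (-1) ^ (a : ℕ) =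
        (-1) ^ (i : ℕ) * (Equiv.Perm.sign σ : ℤˣ) := by
      rw [sign_insertPerm, mul_assoc, show ((e a : Fin _) : ℕ) = a from rfl, ← mul_pow]
      simp
    simp only [Function.comp_def, hA', hB', ha, ← hlt, smul_mul_assoc, smul_smul, hsign,
      lodayLeftTerm]

open Classical in
lemma shuffleMul_lodayD_right (hN : p + (q + 1) = p + q + 1) :
    ((-1 : ℤ) ^ p) • shuffleMul ℓ₁ (lodayD brk (fun u f => ρ u f) ℓ₂) (x ∘ Fin.cast hN) =
      ∑ i, ∑ σ with IsColourShuffle (fun l => decide ((l : ℕ) < p)) σ,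
        lodayRightTerm brk ρ ℓ₁ ℓ₂ x i σ := by
  let e : Fin (q + 1) → Fin (p + q + 1) := fun a => Fin.cast hN (Fin.natAdd p a)
  have hcol : ∀ a : Fin (p + q + 1), decide ((a : ℕ) < p) = false →
      ∀ l, decide ((a.succAbove l : ℕ) < p) = decide ((l : ℕ) < p) := by
    intro a ha l
    simp only [decide_eq_false_iff_not, decide_eq_decide, Fin.succAbove, Fin.lt_def] at ha ⊢
    split_ifs with h <;> simp at h ⊢
    omega
  have hA : ∀ a m, e (a.succAbove m) = (e a).succAbove (Fin.natAdd p m) := by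
    intro a m
    ext
    simp only [e, Fin.succAbove, Fin.lt_def, Fin.val_cast, Fin.val_natAdd, Fin.val_castSucc,
      Nat.add_lt_add_iff_left]
    split_ifs <;> simp [add_assoc]
  have hB : ∀ a m, Fin.cast hN (Fin.castAdd (q + 1) m) = (e a).succAbove (Fin.castAdd q m) := by
    intro a m
    ext
    simp only [e, Fin.succAbove, Fin.lt_def, Fin.val_cast, Fin.val_castAdd, Fin.val_castSucc,
      Fin.val_natAdd]
    split_ifs <;> simp
    omega
  rw [shuffleMul_comp_cast hN]
  simp only [lodayD_eq_sum_partialLie, Finset.mul_sum, Finset.smul_sum]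
  refine sum_isColourShuffle_insertPerm hcol e ?_ ?_ _ _ ?_
  · exact (Fin.cast_injective hN).comp (Fin.natAdd_injective _ _)
  · intro a
    rw [decide_eq_false_iff_not]
    constructor
    · exact fun h => ⟨⟨a - p, by omega⟩, Fin.ext (by simp [e]; omega)⟩
    · rintro ⟨m, rfl⟩
      simp [e]
  · intro a i σ h
    have hlt : ∀ m, i < i.succAbove (σ (Fin.natAdd p m)) ↔ a < a.succAbove m := by
      intro m
      rw [h.lt_iff (hcol _ (by simp [e])) (by simp [e]), ← hA]
      exact Nat.add_lt_add_iff_left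
    have hA' : ∀ m, insertPerm (e a) i σ (Fin.cast hN (Fin.natAdd p (a.succAbove m))) =
        i.succAbove (σ (Fin.natAdd p m)) := fun m =>
      (congrArg _ (hA a m)).trans (insertPerm_succAbove _ _ _ _)
    have hB' : ∀ m, insertPerm (e a) i σ (Fin.cast hN (Fin.castAdd (q + 1) m)) =
        i.succAbove (σ (Fin.castAdd q m)) := fun m =>
      (congrArg _ (hB a m)).trans (insertPerm_succAbove _ _ _ _)
    have ha : insertPerm (e a) i σ (Fin.cast hN (Fin.natAdd p a)) = i := insertPerm_self _ _ _
    have hsign : (-1) ^ p * (((Equiv.Perm.sign (insertPerm (e a) i σ) : ℤˣ) : ℤ) *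
        (-1) ^ (a : ℕ)) = (-1) ^ (i : ℕ) * (Equiv.Perm.sign σ : ℤˣ) := by
      rw [mul_left_comm, ← pow_add, sign_insertPerm, mul_assoc,
        show ((e a : Fin _) : ℕ) = p + a from rfl, ← mul_pow]
      simp
    simp only [Function.comp_def, hA', hB', ha, ← hlt, mul_smul_comm, smul_smul, hsign,
      lodayRightTerm]

end derivation

/-- The Loday operator `∂_B` associated with a bracket on an `A`-module `E` and a map
`ρ : E → Der(A)` is a degree 1 graded derivation of the shuffle product:
`∂_B(ℓ′⋔ℓ″) = (∂_B ℓ′)⋔ℓ″ + (−1)^p ℓ′⋔(∂_B ℓ″)` for multilinear cochains. -/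
theorem loday_operator_is_graded_derivation_of_shuffle
    {k : Type*} [Field k] [CharZero k]
    {A : Type*} [CommRing A] [Algebra k A]
    {E : Type*} [AddCommGroup E] [Module A E]
    [Module k E] [IsScalarTower k A E]
    (b : E →ₗ[k] E →ₗ[k] E) (ρ : E → Derivation k A A)
    (p q : ℕ)
    (ℓ₁ : MultilinearMap k (fun _ : Fin p => E) A)
    (ℓ₂ : MultilinearMap k (fun _ : Fin q => E) A)
    (x : Fin (p + q + 1) → E) :
    lodayD (fun u v => b u v) (fun u f => ρ u f) (shuffleMul ⇑ℓ₁ ⇑ℓ₂) x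
      = shuffleMul (lodayD (fun u v => b u v) (fun u f => ρ u f) ⇑ℓ₁) ⇑ℓ₂
          (x ∘ Fin.cast (by omega : p + 1 + q = p + q + 1))
        + ((-1 : ℤ) ^ p) •
          shuffleMul ⇑ℓ₁ (lodayD (fun u v => b u v) (fun u f => ρ u f) ⇑ℓ₂)
            (x ∘ Fin.cast (by omega : p + (q + 1) = p + q + 1)) := by
  rw [lodayD_shuffleMul, shuffleMul_lodayD_left, shuffleMul_lodayD_right]
  simp only [Finset.sum_add_distrib]
end
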